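/- arXiv:1708.09708 — 2 statements merged into one kernel-verified Lean document; each statement's English description precedes it below -/
import Mathlib

section
/- Let h : A → B be a function between finite alphabets and σ = ((λ_i,a_i))_{i=1}^L a stream over A. For the event map p(λ,a) = exp(λa), the bias of the pulled-back feature at a word w of length M is exactly Φ_{h,w}(σ) − Φ_w(σ) = Σ λ_{i_1}⋯λ_{i_M}/𝐢!, the sum over all nondecreasing index tuples 1 ≤ i_1 ≤ ⋯ ≤ i_M ≤ L such that the letter word a_{i_1}⋯a_{i_M} is different from w but h(a_{i_1})⋯h(a_{i_M}) = h(w). -/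
open scoped BigOperators Classical

/-- Feature coordinates of a stream `σ` at a word `w` for the event map `p(λ,a) = 1 + λ a`:
the sum over all strictly increasing index tuples whose letters spell `w` of the product of
the counter increases. -/
noncomputable def Phi {A : Type*} (σ : List (ℝ × A)) (w : List A) : ℝ :=
  ∑ i : Fin w.length → Fin σ.length,
    if (∀ j k : Fin w.length, j < k → i j < i k) ∧
        (∀ j : Fin w.length, (σ.get (i j)).2 = w.get j) then
      ∏ j : Fin w.length, (σ.get (i j)).1
    else 0

/-- The block factorial `𝐢!` of a (nondecreasing) index tuple: the product over values of the
factorial of the number of occurrences. -/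
def iFact {M L : ℕ} (i : Fin M → Fin L) : ℕ :=
  ∏ v : Fin L, Nat.factorial ((List.ofFn i).count v)

/-- Feature coordinates of a stream `σ` at a word `w` for the event map `p(λ,a) = exp(λ a)`:
the sum over all nondecreasing index tuples whose letters spell `w` of the product of the
counter increases divided by the block factorial `𝐢!`. -/
noncomputable def PhiExp {A : Type*} (σ : List (ℝ × A)) (w : List A) : ℝ :=
  ∑ i : Fin w.length → Fin σ.length,
    if (∀ j k : Fin w.length, j ≤ k → i j ≤ i k) ∧
        (∀ j : Fin w.length, (σ.get (i j)).2 = w.get j) then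
      (∏ j : Fin w.length, (σ.get (i j)).1) / (iFact i : ℝ)
    else 0

/-- The hashed stream `σ^h`. -/
def hashStream {A B : Type*} (h : A → B) (σ : List (ℝ × A)) : List (ℝ × B) :=
  σ.map (fun e => (e.1, h e.2))

/-- Pulled-back features `Φ_{h,w}(σ) := Φ_{h(w)}(σ^h)` for the event map `p(λ,a) = 1 + λ a`. -/
noncomputable def PhiH {A B : Type*} (h : A → B) (σ : List (ℝ × A)) (w : List A) : ℝ :=
  Phi (hashStream h σ) (w.map h)

/-- Pulled-back features `Φ_{h,w}(σ) := Φ_{h(w)}(σ^h)` for the event map `p(λ,a) = exp(λ a)`. -/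
noncomputable def PhiExpH {A B : Type*} (h : A → B) (σ : List (ℝ × A)) (w : List A) : ℝ :=
  PhiExp (hashStream h σ) (w.map h)

/-- `‖Φ(σ)‖_{1,(M)}`: the sum of the features over all words of length `M`. -/
noncomputable def phiNorm {A : Type*} [Fintype A] (σ : List (ℝ × A)) (M : ℕ) : ℝ :=
  ∑ f : Fin M → A, Phi σ (List.ofFn f)

/-- Probability of an event `S` under a finitely supported weight `p`. -/
noncomputable def pr {Ω : Type*} [Fintype Ω] (p : Ω → ℝ) (S : Ω → Prop) : ℝ :=
  ∑ ω : Ω, if S ω then p ω else 0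

/-- Expectation of `f` under a finitely supported weight `p`. -/
noncomputable def expec {Ω : Type*} [Fintype Ω] (p : Ω → ℝ) (f : Ω → ℝ) : ℝ :=
  ∑ ω : Ω, p ω * f ω

/-- `PhiExp` as a sum over index tuples between types of prescribed sizes. -/
theorem PhiExp_eq_sum_cast {A : Type*} (σ : List (ℝ × A)) (w : List A) {M L : ℕ}
    (hM : M = w.length) (hL : L = σ.length) :
    PhiExp σ w = ∑ i : Fin M → Fin L,
      if (∀ j k : Fin M, j ≤ k → i j ≤ i k) ∧
          (∀ j : Fin M, (σ.get (Fin.cast hL (i j))).2 = w.get (Fin.cast hM j)) then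
        (∏ j : Fin M, (σ.get (Fin.cast hL (i j))).1) / (iFact i : ℝ)
      else 0 := by
  subst hM hL
  rfl

/-- The pulled-back feature as a sum over the index tuples of the original stream. -/
theorem PhiExpH_eq_sum {A B : Type*} (h : A → B) (σ : List (ℝ × A)) (w : List A) :
    PhiExpH h σ w = ∑ i : Fin w.length → Fin σ.length,
      if (∀ j k : Fin w.length, j ≤ k → i j ≤ i k) ∧
          (∀ j : Fin w.length, h (σ.get (i j)).2 = h (w.get j)) then
        (∏ j : Fin w.length, (σ.get (i j)).1) / (iFact i : ℝ)
      else 0 := by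
  rw [PhiExpH, PhiExp_eq_sum_cast (hashStream h σ) (w.map h) (M := w.length) (L := σ.length)
    (by simp) (by simp [hashStream])]
  simp only [hashStream, List.get_eq_getElem, List.getElem_map, Fin.val_cast]
  rfl

/-- A list tabulated on the positions of `w` equals `w` iff it does so entrywise. -/
theorem ofFn_eq_iff_forall_get {A : Type*} (w : List A) (f : Fin w.length → A) :
    List.ofFn f = w ↔ ∀ j, f j = w.get j := by
  conv_lhs => rhs; rw [← List.ofFn_get w]
  rw [List.ofFn_inj, funext_iff]

/-- The image of a list tabulated on the positions of `w` equals that of `w` iff it does so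
entrywise. -/
theorem map_ofFn_eq_map_iff_forall_get {A B : Type*} (h : A → B) (w : List A)
    (f : Fin w.length → A) :
    (List.ofFn f).map h = w.map h ↔ ∀ j, h (f j) = h (w.get j) := by
  conv_lhs => rhs; rw [← List.ofFn_get w]
  rw [List.map_ofFn, List.map_ofFn, List.ofFn_inj, funext_iff]
  rfl

/-- Exact bias formula for the event map `p(λ,a) = exp(λ a)`: the bias at the word `w` is the
sum over nondecreasing index tuples whose letter word differs from `w` but hashes to the hash
of `w`, of `λ(𝐢)/𝐢!`. -/
theorem bias_formula_exp {A B : Type*} [Fintype A] [Fintype B]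
    (h : A → B) (σ : List (ℝ × A)) (hσ : ∀ e ∈ σ, 0 < e.1) (w : List A) :
    PhiExpH h σ w - PhiExp σ w =
      ∑ i : Fin w.length → Fin σ.length,
        if (∀ j k : Fin w.length, j ≤ k → i j ≤ i k) ∧
            List.ofFn (fun j => (σ.get (i j)).2) ≠ w ∧
            (List.ofFn (fun j => (σ.get (i j)).2)).map h = w.map h then
          (∏ j : Fin w.length, (σ.get (i j)).1) / (iFact i : ℝ)
        else 0 := by
  rw [PhiExpH_eq_sum, PhiExp, ← Finset.sum_sub_distrib]
  refine Finset.sum_congr rfl fun i _ => ?_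
  simp only [ne_eq, ofFn_eq_iff_forall_get, map_ofFn_eq_map_iff_forall_get]
  by_cases hmono : ∀ j k : Fin w.length, j ≤ k → i j ≤ i k
  · by_cases hw : ∀ j, (σ.get (i j)).2 = w.get j
    · have hh : ∀ j, h (σ.get (i j)).2 = h (w.get j) := fun j => congrArg h (hw j)
      rw [if_pos ⟨hmono, hh⟩, if_pos ⟨hmono, hw⟩, if_neg fun hc => hc.2.1 hw, sub_self]
    · rw [if_neg fun hc : _ ∧ _ => hw hc.2, sub_zero]
      exact if_congr (by tauto) rfl rfl
  · rw [if_neg fun hc => hmono hc.1, if_neg fun hc => hmono hc.1,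
      if_neg fun hc => hmono hc.1, sub_zero]
end

section
/- Let ε, δ > 0, let 𝓗 be a 2-universal family of functions from a finite alphabet A into a finite alphabet B with |B| = ⌈2/ε⌉, let H_1, …, H_r be drawn independently and uniformly from 𝓗 with r = ⌈log_2(1/δ)⌉, and let Φ̂_w(σ) := min_{j=1,…,r} Φ_{H_j,w}(σ) be the (ε,δ)-count-min sketch. Then for every stream σ over A and every word w over A of length M, ℙ( Φ_w(σ) ∈ [Φ̂_w(σ) − ε‖Φ(σ)‖_{1,(M)}, Φ̂_w(σ)] ) ≥ 1 − δ, where the features are taken with respect to the event map p(λ,a) = 1+λa. -/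
open scoped BigOperators Classical

/-- The weight of an index tuple: the product of its counter increases if it is strictly
increasing, and `0` otherwise. -/
noncomputable def tupleWeight {L M : ℕ} (lam : Fin L → ℝ) (i : Fin M → Fin L) : ℝ :=
  if StrictMono i then ∏ j, lam (i j) else 0

lemma tupleWeight_nonneg {L M : ℕ} {lam : Fin L → ℝ} (hlam : ∀ k, 0 < lam k)
    (i : Fin M → Fin L) : 0 ≤ tupleWeight lam i := by
  unfold tupleWeight
  split_ifs
  · exact Finset.prod_nonneg fun j _ => (hlam _).le
  · exact le_rfl

lemma Phi_ofFn {A : Type*} {L M : ℕ} (lam : Fin L → ℝ) (a : Fin L → A) (f : Fin M → A) :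
    Phi (List.ofFn fun k => (lam k, a k)) (List.ofFn f) =
      ∑ i : Fin M → Fin L, if a ∘ i = f then tupleWeight lam i else 0 := by
  unfold Phi
  refine Fintype.sum_equiv
    ((finCongr List.length_ofFn).arrowCongr (finCongr List.length_ofFn)) _ _ fun i => ?_
  set i' := (finCongr (List.length_ofFn (f := f))).arrowCongr
    (finCongr (List.length_ofFn (f := fun k => (lam k, a k)))) i with hi'
  have hval : ∀ j, (finCongr (List.length_ofFn (f := fun k => (lam k, a k)))) (i j) =
      i' (finCongr (List.length_ofFn (f := f)) j) := by
    intro j; simp [hi', Equiv.arrowCongr]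
  have hget : ∀ j, (List.ofFn fun k => (lam k, a k)).get (i j) =
      (lam (i' (finCongr List.length_ofFn j)), a (i' (finCongr List.length_ofFn j))) := by
    intro j
    rw [← hval, List.get_ofFn]
    rfl
  have hmono : (∀ j k, j < k → i j < i k) ↔ StrictMono i' := by
    constructor
    · intro h j k hjk
      exact h _ _ hjk
    · intro h j k hjk
      exact h (a := finCongr List.length_ofFn j) (b := finCongr List.length_ofFn k) hjk
  have hword : (∀ j, ((List.ofFn fun k => (lam k, a k)).get (i j)).2 = (List.ofFn f).get j) ↔
      a ∘ i' = f := by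
    rw [funext_iff, ← (finCongr (List.length_ofFn (f := f))).forall_congr_right]
    refine forall_congr' fun j => ?_
    rw [hget, List.get_ofFn]
    rfl
  have hprod : ∏ j, ((List.ofFn fun k => (lam k, a k)).get (i j)).1 = ∏ j, lam (i' j) :=
    Fintype.prod_equiv (finCongr List.length_ofFn) _ _ fun j => by rw [hget]
  simp only [hmono, hword, hprod, tupleWeight]
  split_ifs <;> tauto

lemma PhiH_ofFn {A B : Type*} {L M : ℕ} (h : A → B) (lam : Fin L → ℝ) (a : Fin L → A)
    (f : Fin M → A) :
    PhiH h (List.ofFn fun k => (lam k, a k)) (List.ofFn f) =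
      ∑ i : Fin M → Fin L, if h ∘ a ∘ i = h ∘ f then tupleWeight lam i else 0 := by
  unfold PhiH hashStream
  rw [List.map_ofFn, List.map_ofFn]
  exact Phi_ofFn lam (h ∘ a) (h ∘ f)

lemma phiNorm_ofFn {A : Type*} [Fintype A] {L : ℕ} (M : ℕ) (lam : Fin L → ℝ) (a : Fin L → A) :
    phiNorm (List.ofFn fun k => (lam k, a k)) M =
      ∑ i : Fin M → Fin L, tupleWeight lam i := by
  unfold phiNorm
  simp_rw [Phi_ofFn]
  rw [Finset.sum_comm]
  refine Finset.sum_congr rfl fun i _ => ?_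
  simp

/-- Every stream with positive counter increases is of the form `k ↦ (lam k, a k)`. -/
lemma exists_stream_eq_ofFn {A : Type*} (σ : List (ℝ × A)) (hσ : ∀ e ∈ σ, 0 < e.1) :
    ∃ (lam : Fin σ.length → ℝ) (a : Fin σ.length → A),
      (∀ k, 0 < lam k) ∧ σ = List.ofFn fun k => (lam k, a k) :=
  ⟨fun k => (σ.get k).1, fun k => (σ.get k).2, fun _ => hσ _ (List.get_mem _ _),
    (List.ofFn_get σ).symm⟩

/-- Hashing never decreases a feature. -/
lemma Phi_le_PhiH {A B : Type*} (h : A → B) (σ : List (ℝ × A)) (hσ : ∀ e ∈ σ, 0 < e.1)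
    (w : List A) : Phi σ w ≤ PhiH h σ w := by
  obtain ⟨lam, a, hlam, hs⟩ := exists_stream_eq_ofFn σ hσ
  rw [hs, ← List.ofFn_get w, Phi_ofFn, PhiH_ofFn]
  refine Finset.sum_le_sum fun i _ => ?_
  have := tupleWeight_nonneg hlam i
  by_cases hf : a ∘ i = w.get
  · simp [hf]
  · rw [if_neg hf]
    split_ifs
    exacts [this, le_rfl]

lemma Phi_nonneg {A : Type*} (σ : List (ℝ × A)) (hσ : ∀ e ∈ σ, 0 < e.1) (w : List A) :
    0 ≤ Phi σ w := by
  obtain ⟨lam, a, hlam, hs⟩ := exists_stream_eq_ofFn σ hσ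
  rw [hs, ← List.ofFn_get w, Phi_ofFn]
  refine Finset.sum_nonneg fun i _ => ?_
  split_ifs
  exacts [tupleWeight_nonneg hlam i, le_rfl]

lemma PhiH_le_phiNorm {A B : Type*} [Fintype A] (h : A → B) (σ : List (ℝ × A))
    (hσ : ∀ e ∈ σ, 0 < e.1) (w : List A) : PhiH h σ w ≤ phiNorm σ w.length := by
  obtain ⟨lam, a, hlam, hs⟩ := exists_stream_eq_ofFn σ hσ
  conv_lhs => rw [hs, ← List.ofFn_get w, PhiH_ofFn]
  conv_rhs => rw [hs, phiNorm_ofFn]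
  refine Finset.sum_le_sum fun i _ => ?_
  split_ifs
  exacts [le_rfl, tupleWeight_nonneg hlam i]

/-- Total overestimation of a feature over a family whose collision counts are at most `c`. -/
lemma sum_PhiH_sub_Phi_le {A B : Type*} [Fintype A] (𝓗 : Finset (A → B)) (c : ℝ) (hc : 0 ≤ c)
    (hcoll : ∀ a b : A, a ≠ b → ((𝓗.filter fun h => h a = h b).card : ℝ) ≤ c)
    (σ : List (ℝ × A)) (hσ : ∀ e ∈ σ, 0 < e.1) (w : List A) :
    ∑ h ∈ 𝓗, (PhiH h σ w - Phi σ w) ≤ c * phiNorm σ w.length := by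
  obtain ⟨lam, a, hlam, hs⟩ := exists_stream_eq_ofFn σ hσ
  have hdiff : ∀ h : A → B, PhiH h σ w - Phi σ w = ∑ i : Fin w.length → Fin σ.length,
      if a ∘ i ≠ w.get ∧ h ∘ a ∘ i = h ∘ w.get then tupleWeight lam i else 0 := by
    intro h
    conv_lhs => rw [hs, ← List.ofFn_get w, Phi_ofFn, PhiH_ofFn, ← Finset.sum_sub_distrib]
    refine Finset.sum_congr rfl fun i _ => ?_
    by_cases hf : a ∘ i = w.get
    · simp [hf]
    · simp [hf]
  have hnorm : phiNorm σ w.length = ∑ i : Fin w.length → Fin σ.length, tupleWeight lam i := by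
    conv_lhs => rw [hs, phiNorm_ofFn]
  rw [hnorm, Finset.mul_sum, Finset.sum_congr rfl fun h _ => hdiff h, Finset.sum_comm]
  refine Finset.sum_le_sum fun i _ => ?_
  rw [← Finset.sum_filter, Finset.sum_const, nsmul_eq_mul]
  refine mul_le_mul_of_nonneg_right ?_ (tupleWeight_nonneg hlam i)
  by_cases hf : a ∘ i = w.get
  · simpa [hf] using hc
  · obtain ⟨j, hj⟩ := Function.ne_iff.mp hf
    refine le_trans ?_ (hcoll _ _ hj)
    refine Nat.cast_le.mpr (Finset.card_le_card fun h hh => ?_)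
    rw [Finset.mem_filter] at hh ⊢
    exact ⟨hh.1, congrFun hh.2.2 j⟩

/-- At most half of a `2`-universal family overestimates a feature by more than
`ε‖Φ(σ)‖_{1,(M)}`. -/
lemma two_mul_card_overestimate_le {A B : Type*} [Fintype A] [Fintype B] (ε : ℝ) (hε : 0 < ε)
    (hB : Fintype.card B = ⌈2 / ε⌉₊) (𝓗 : Finset (A → B)) (h𝓗 : 𝓗.Nonempty)
    (huniv : ∀ a b : A, a ≠ b →
      ((𝓗.filter fun h => h a = h b).card : ℝ) / (𝓗.card : ℝ) ≤ 1 / (Fintype.card B : ℝ))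
    (σ : List (ℝ × A)) (hσ : ∀ e ∈ σ, 0 < e.1) (w : List A) :
    2 * ((𝓗.filter fun h => Phi σ w + ε * phiNorm σ w.length < PhiH h σ w).card : ℝ) ≤
      𝓗.card := by
  have hcard : (0 : ℝ) < 𝓗.card := by exact_mod_cast h𝓗.card_pos
  have hceil : 2 / ε ≤ (Fintype.card B : ℝ) := hB ▸ Nat.le_ceil _
  have hinv : 1 / (Fintype.card B : ℝ) ≤ ε / 2 := by
    calc 1 / (Fintype.card B : ℝ) ≤ 1 / (2 / ε) := one_div_le_one_div_of_le (by positivity) hceil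
      _ = ε / 2 := by field_simp
  have hsum := sum_PhiH_sub_Phi_le 𝓗 (ε / 2 * 𝓗.card) (by positivity)
    (fun a b hab => (div_le_iff₀ hcard).mp ((huniv a b hab).trans hinv)) σ hσ w
  have hmarkov : ((𝓗.filter fun h => Phi σ w + ε * phiNorm σ w.length < PhiH h σ w).card : ℝ) *
      (ε * phiNorm σ w.length) ≤ ∑ h ∈ 𝓗, (PhiH h σ w - Phi σ w) := by
    rw [← nsmul_eq_mul]
    refine (Finset.card_nsmul_le_sum _ (fun h => PhiH h σ w - Phi σ w) _ fun h hh => ?_).trans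
      (Finset.sum_le_sum_of_subset_of_nonneg (Finset.filter_subset _ _) fun h _ _ =>
        sub_nonneg.mpr (Phi_le_PhiH h σ hσ w))
    have := (Finset.mem_filter.mp hh).2
    linarith
  have hPhi := Phi_nonneg σ hσ w
  obtain ⟨h₀, -⟩ := h𝓗
  have hN : 0 ≤ phiNorm σ w.length :=
    (hPhi.trans (Phi_le_PhiH h₀ σ hσ w)).trans (PhiH_le_phiNorm h₀ σ hσ w)
  rcases hN.eq_or_lt with hN | hN
  · rw [Finset.filter_false_of_mem]
    · simp
    · intro h _
      have := PhiH_le_phiNorm h σ hσ w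
      rw [← hN] at this ⊢
      linarith
  · refine le_of_mul_le_mul_right ?_ (mul_pos hε hN)
    linarith

lemma pr_const {Ω : Type*} [Fintype Ω] (c : ℝ) (S : Ω → Prop) :
    pr (fun _ => c) S = (Finset.univ.filter S).card * c := by
  rw [pr, ← Finset.sum_filter, Finset.sum_const, nsmul_eq_mul]

/-- If at most half of a finite set is bad, then `r` independent uniform draws are not all bad
with probability at least `1 - 2⁻ʳ`. -/
lemma one_sub_half_pow_le_pr {X : Type*} (s : Finset X) (hs : s.Nonempty) (bad : X → Prop)
    (hbad : 2 * ((s.filter bad).card : ℝ) ≤ s.card) (r : ℕ) (S : (Fin r → ↥s) → Prop)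
    (hS : ∀ ω, (∃ j, ¬ bad (ω j).1) → S ω) :
    1 - (1 / 2 : ℝ) ^ r ≤ pr (fun _ : Fin r → ↥s => 1 / (s.card : ℝ) ^ r) S := by
  have hcard : (0 : ℝ) < s.card := by exact_mod_cast hs.card_pos
  have hsplit : pr (fun _ : Fin r → ↥s => 1 / (s.card : ℝ) ^ r) S +
      pr (fun _ : Fin r → ↥s => 1 / (s.card : ℝ) ^ r) (fun ω => ¬ S ω) = 1 := by
    unfold pr
    rw [← Finset.sum_add_distrib]
    have : ∀ ω : Fin r → ↥s, ((if S ω then 1 / (s.card : ℝ) ^ r else 0) +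
        if ¬ S ω then 1 / (s.card : ℝ) ^ r else 0) = 1 / (s.card : ℝ) ^ r := by
      intro ω
      by_cases h : S ω <;> simp [h]
    simp_rw [this]
    simp [hcard.ne']
  have hsub : (Finset.univ.filter fun ω : Fin r → ↥s => ¬ S ω) ⊆
      Fintype.piFinset fun _ => Finset.univ.filter fun x : ↥s => bad x.1 := by
    intro ω hω
    rw [Fintype.mem_piFinset]
    intro j
    by_contra hj
    exact (Finset.mem_filter.mp hω).2 (hS ω ⟨j, by simpa using hj⟩)
  have hsubcard : (Finset.univ.filter fun x : ↥s => bad x.1).card = (s.filter bad).card := by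
    rw [← Finset.card_map (Function.Embedding.subtype (· ∈ s))]
    congr 1
    ext x
    simp [and_comm]
  have hcount : ((Finset.univ.filter fun ω : Fin r → ↥s => ¬ S ω).card : ℝ) ≤
      ((s.filter bad).card : ℝ) ^ r := by
    have := Finset.card_le_card hsub
    rw [Fintype.card_piFinset_const, hsubcard] at this
    exact_mod_cast this
  have hfail : pr (fun _ : Fin r → ↥s => 1 / (s.card : ℝ) ^ r) (fun ω => ¬ S ω) ≤
      (1 / 2 : ℝ) ^ r := by
    rw [pr_const, mul_one_div, div_le_iff₀ (by positivity), ← mul_pow]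
    refine le_trans (le_of_eq ?_) (hcount.trans (pow_le_pow_left₀ (by positivity) (by linarith) r))
    congr!
  linarith

/-- Guarantee for the `(ε,δ)`-count-min sketch `Φ̂_w(σ) = min_j Φ_{H_j,w}(σ)`, built from
`r = ⌈log₂(1/δ)⌉` independent uniform draws from a 2-universal family into an alphabet `B`
with `|B| = ⌈2/ε⌉`: with probability at least `1 - δ`, the true feature `Φ_w(σ)` lies in
`[Φ̂_w(σ) - ε‖Φ(σ)‖_{1,(M)}, Φ̂_w(σ)]`.  Features use the event map `p(λ,a) = 1 + λ a`. -/
theorem count_min_sketch_guarantee {A B : Type*} [Fintype A] [Fintype B]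
    (ε δ : ℝ) (hε : 0 < ε) (hδ : 0 < δ)
    (hB : Fintype.card B = ⌈2 / ε⌉₊)
    (𝓗 : Finset (A → B)) (h𝓗 : 𝓗.Nonempty)
    (huniv : ∀ a b : A, a ≠ b →
      ((𝓗.filter fun h => h a = h b).card : ℝ) / (𝓗.card : ℝ) ≤ 1 / (Fintype.card B : ℝ))
    (r : ℕ) (hr : r = ⌈Real.logb 2 (1 / δ)⌉₊)
    (σ : List (ℝ × A)) (hσ : ∀ e ∈ σ, 0 < e.1)
    (M : ℕ) (w : List A) (hw : w.length = M) :
    1 - δ ≤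
      pr (fun _ : Fin r → ↥𝓗 => 1 / (𝓗.card : ℝ) ^ r)
        (fun ω =>
          (⨅ j : Fin r, PhiH (ω j).1 σ w) - ε * phiNorm σ M ≤ Phi σ w ∧
            Phi σ w ≤ ⨅ j : Fin r, PhiH (ω j).1 σ w) := by
  subst hw
  have hlog : Real.logb 2 (1 / δ) ≤ r := hr ▸ Nat.le_ceil _
  have hpow : (1 / 2 : ℝ) ^ r ≤ δ := by
    rw [Real.logb_le_iff_le_rpow one_lt_two (by positivity), Real.rpow_natCast] at hlog
    rw [one_div_pow]
    exact (one_div_le hδ (by positivity)).mp hlog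
  rcases Nat.eq_zero_or_pos r with hr0 | hrpos
  · have hδ1 : 1 ≤ δ := by simpa [hr0] using hpow
    refine (sub_nonpos.mpr hδ1).trans (Finset.sum_nonneg fun ω _ => ?_)
    split_ifs <;> positivity
  have : Nonempty (Fin r) := ⟨⟨0, hrpos⟩⟩
  refine (sub_le_sub_left hpow 1).trans (one_sub_half_pow_le_pr 𝓗 h𝓗 _
    (two_mul_card_overestimate_le ε hε hB 𝓗 h𝓗 huniv σ hσ w) r _ ?_)
  rintro ω ⟨j, hj⟩
  refine ⟨?_, le_ciInf fun j => Phi_le_PhiH _ σ hσ w⟩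
  have hinf : ⨅ j : Fin r, PhiH (ω j).1 σ w ≤ PhiH (ω j).1 σ w :=
    ciInf_le (Set.finite_range _).bddBelow j
  linarith [not_lt.mp hj]
end
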